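/- arXiv:1604.02712 — 3 statements merged into one kernel-verified Lean document; each statement's English description precedes it below -/
import Mathlib

section
/- Let n ≥ 2 be an integer and let π ∈ Π_n. Then the number of matrices π' ∈ Π_n disjoint from π equals Σ_{k=2}^{n²} (−1)^k q(n,k), where q(n,k) = Σ over n×n binary matrices A with exactly k ones of ∏_{i=0}^{n} [(n−i)!]^{ψ_i(A)}. -/
def IsPiMatrix (n : ℕ) (π : Fin n → Fin n → Fin n × Fin n) : Prop :=
  (∀ i : Fin n, Function.Bijective fun j => (π i j).1) ∧
  (∀ j : Fin n, Function.Bijective fun i => (π i j).2)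

def DisjointPi (n : ℕ) (π π' : Fin n → Fin n → Fin n × Fin n) : Prop :=
  ∀ i j : Fin n, π i j ≠ π' i j

def rowCount (n : ℕ) (A : Fin n → Fin n → Fin 2) (k : ℕ) : ℕ :=
  (Finset.univ.filter fun i : Fin n =>
    (Finset.univ.filter fun j : Fin n => A i j = 1).card = k).card

def colCount (n : ℕ) (A : Fin n → Fin n → Fin 2) (k : ℕ) : ℕ :=
  (Finset.univ.filter fun j : Fin n =>
    (Finset.univ.filter fun i : Fin n => A i j = 1).card = k).card

def psi (n : ℕ) (A : Fin n → Fin n → Fin 2) (k : ℕ) : ℕ :=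
  rowCount n A k + colCount n A k

def eps (n : ℕ) (A : Fin n → Fin n → Fin 2) : ℕ :=
  (Finset.univ.filter fun p : Fin n × Fin n => A p.1 p.2 = 1).card

def q (n k : ℕ) : ℕ :=
  ∑ A ∈ Finset.univ.filter (fun A : Fin n → Fin n → Fin 2 => eps n A = k),
    ∏ i ∈ Finset.range (n + 1), (Nat.factorial (n - i)) ^ (psi n A i)

open Finset

theorem card_perm_eqOn {α : Type*} [Fintype α] [DecidableEq α] (σ₀ : Equiv.Perm α)
    (s : Finset α) [DecidablePred fun σ : Equiv.Perm α => ∀ a ∈ s, σ a = σ₀ a] :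
    #{σ : Equiv.Perm α | ∀ a ∈ s, σ a = σ₀ a} =
      (Fintype.card α - #s).factorial := by
  have e₁ : {σ : Equiv.Perm α // ∀ a ∈ s, σ a = σ₀ a} ≃
      {σ : Equiv.Perm α // ∀ a, ¬ a ∉ s → σ a = a} :=
    (Equiv.mulLeft σ₀⁻¹).subtypeEquiv fun σ => by
      simp [Equiv.symm_apply_eq]
  rw [← Fintype.card_subtype, Fintype.card_congr (e₁.trans (Equiv.Perm.subtypeEquivSubtypePerm (· ∉ s)).symm),
    Fintype.card_perm, Fintype.card_subtype_compl, Fintype.card_coe]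

/-- A pair of families of permutations (the rows of the first coordinates, the columns of the
second coordinates) is the same as a matrix in `Π_n`. -/
noncomputable def piMatrixEquiv (n : ℕ) :
    (Fin n → Equiv.Perm (Fin n)) × (Fin n → Equiv.Perm (Fin n)) ≃
      {π : Fin n → Fin n → Fin n × Fin n // IsPiMatrix n π} where
  toFun f := ⟨fun i j => (f.1 i j, f.2 j i), fun i => (f.1 i).bijective,
    fun j => (f.2 j).bijective⟩
  invFun π := (fun i => Equiv.ofBijective _ (π.2.1 i), fun j => Equiv.ofBijective _ (π.2.2 j))
  left_inv f := by ext <;> rfl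
  right_inv π := rfl

/-- The product of `(n - r)!` over all row and column sums `r` of `A`. -/
def lineWeight (n : ℕ) (A : Fin n → Fin n → Fin 2) : ℕ :=
  (∏ i, (n - #{j | A i j = 1}).factorial) * ∏ j, (n - #{i | A i j = 1}).factorial

theorem prod_factorial_pow_psi (n : ℕ) (A : Fin n → Fin n → Fin 2) :
    ∏ i ∈ range (n + 1), (Nat.factorial (n - i)) ^ (psi n A i) = lineWeight n A := by
  have key (g : Fin n → ℕ) (hg : ∀ i, g i ≤ n) :
      ∏ k ∈ range (n + 1), (n - k).factorial ^ #{i | g i = k} = ∏ i, (n - g i).factorial := by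
    rw [← prod_fiberwise_of_maps_to (s := univ) (t := range (n + 1)) (g := g)
      (fun i _ => by simpa [Nat.lt_succ_iff] using hg i)]
    refine prod_congr rfl fun k _ => ?_
    rw [← prod_const]
    refine prod_congr rfl fun i hi => ?_
    rw [(mem_filter.1 hi).2]
  simp only [psi, pow_add, prod_mul_distrib, rowCount, colCount, lineWeight]
  rw [key (fun i => #{j | A i j = 1}) fun i => (card_le_univ _).trans (Fintype.card_fin n).le,
    key (fun j => #{i | A i j = 1}) fun j => (card_le_univ _).trans (Fintype.card_fin n).le]

theorem card_agree_on (n : ℕ) (f : (Fin n → Equiv.Perm (Fin n)) × (Fin n → Equiv.Perm (Fin n)))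
    (A : Fin n → Fin n → Fin 2) :
    #{g : (Fin n → Equiv.Perm (Fin n)) × (Fin n → Equiv.Perm (Fin n)) |
      ∀ i j, A i j = 1 → f.1 i j = g.1 i j ∧ f.2 j i = g.2 j i} = lineWeight n A := by
  have h : ({g : (Fin n → Equiv.Perm (Fin n)) × (Fin n → Equiv.Perm (Fin n)) |
      ∀ i j, A i j = 1 → f.1 i j = g.1 i j ∧ f.2 j i = g.2 j i} : Finset _) =
      (Fintype.piFinset fun i => {σ | ∀ j ∈ ({j | A i j = 1} : Finset _), σ j = f.1 i j}) ×ˢ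
      (Fintype.piFinset fun j => {σ | ∀ i ∈ ({i | A i j = 1} : Finset _), σ i = f.2 j i}) := by
    ext g
    simp only [mem_filter, mem_univ, true_and, mem_product, Fintype.mem_piFinset]
    exact ⟨fun h => ⟨fun i j hA => (h i j hA).1.symm, fun j i hA => (h i j hA).2.symm⟩,
      fun h i j hA => ⟨(h.1 i j hA).symm, (h.2 j i hA).symm⟩⟩
  rw [h, card_product, Fintype.card_piFinset, Fintype.card_piFinset, lineWeight]
  simp only [card_perm_eqOn, Fintype.card_fin]

theorem prod_prod_ite_neg_one (n : ℕ) (A : Fin n → Fin n → Fin 2) (P : Fin n → Fin n → Prop)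
    [∀ i j, Decidable (P i j)] :
    (∏ i, ∏ j, if A i j = 1 then (if P i j then (-1 : ℤ) else 0) else 1) =
      if ∀ i j, A i j = 1 → P i j then (-1) ^ eps n A else 0 := by
  split_ifs with h
  · rw [← Fintype.prod_prod_type', eps, ← prod_const, prod_filter]
    refine prod_congr rfl fun p _ => ?_
    split_ifs with h₁ h₂
    · rfl
    · exact absurd (h _ _ h₁) h₂
    · rfl
  · push Not at h
    obtain ⟨i, j, hA, hP⟩ := h
    exact prod_eq_zero (mem_univ i) (prod_eq_zero (mem_univ j) (by simp [hA, hP]))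

theorem ite_forall_not_eq_sum (n : ℕ) (P : Fin n → Fin n → Prop) [∀ i j, Decidable (P i j)] :
    (if ∀ i j, ¬ P i j then (1 : ℤ) else 0) =
      ∑ A : Fin n → Fin n → Fin 2,
        if ∀ i j, A i j = 1 → P i j then (-1) ^ eps n A else 0 := by
  simp only [← prod_prod_ite_neg_one]
  have h : (∏ i, ∏ j, ∑ b : Fin 2, if b = 1 then (if P i j then (-1 : ℤ) else 0) else 1) =
      ∑ A : Fin n → Fin n → Fin 2,
        ∏ i, ∏ j, if A i j = 1 then (if P i j then (-1 : ℤ) else 0) else 1 := by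
    simp only [prod_univ_sum, Fintype.piFinset_univ]
  rw [← h]
  split_ifs with hP
  · simp [hP]
  · push Not at hP
    obtain ⟨i, j, hP⟩ := hP
    exact (prod_eq_zero (mem_univ i) (prod_eq_zero (mem_univ j) (by simp [hP]))).symm

theorem card_disjoint_eq_sum_lineWeight (n : ℕ)
    (π : Fin n → Fin n → Fin n × Fin n) (hπ : IsPiMatrix n π) :
    (Nat.card {π' : Fin n → Fin n → Fin n × Fin n //
        IsPiMatrix n π' ∧ DisjointPi n π π'} : ℤ) =
      ∑ A : Fin n → Fin n → Fin 2, (-1 : ℤ) ^ eps n A * (lineWeight n A : ℤ) := by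
  obtain ⟨f, hf⟩ := (piMatrixEquiv n).surjective ⟨π, hπ⟩
  have hf' : π = fun i j => (f.1 i j, f.2 j i) := (congrArg Subtype.val hf).symm
  have e : {π' : Fin n → Fin n → Fin n × Fin n // IsPiMatrix n π' ∧ DisjointPi n π π'} ≃
      {g : (Fin n → Equiv.Perm (Fin n)) × (Fin n → Equiv.Perm (Fin n)) //
        ∀ i j, ¬ (f.1 i j = g.1 i j ∧ f.2 j i = g.2 j i)} :=
    (Equiv.subtypeSubtypeEquivSubtypeInter _ _).symm.trans
      ((piMatrixEquiv n).subtypeEquiv fun g => by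
        rw [hf']
        simp only [DisjointPi, ne_eq, ← Prod.mk_inj]
        rfl).symm
  rw [Nat.card_congr e, Nat.card_eq_fintype_card, Fintype.card_subtype, card_filter]
  push_cast
  simp only [ite_forall_not_eq_sum]
  rw [sum_comm]
  refine sum_congr rfl fun A _ => ?_
  rw [← sum_filter, sum_const, card_agree_on, nsmul_eq_mul, mul_comm]

theorem q_eq_sum_lineWeight (n k : ℕ) :
    q n k = ∑ A with eps n A = k, lineWeight n A := by
  simp only [q, prod_factorial_pow_psi]

theorem q_zero (n : ℕ) : q n 0 = n.factorial ^ n * n.factorial ^ n := by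
  have h : ({A | eps n A = 0} : Finset (Fin n → Fin n → Fin 2)) = {0} := by
    ext A
    simp only [eps, card_eq_zero, filter_eq_empty_iff, mem_filter, mem_univ, true_and,
      mem_singleton, funext_iff, Prod.forall, Pi.zero_apply]
    exact forall_congr' fun i => forall_congr' fun j => by
      simp only [true_imp_iff]; generalize A i j = b; revert b; decide
  simp [q_eq_sum_lineWeight, h, lineWeight]

theorem lineWeight_single (n : ℕ) (p : Fin n × Fin n) :
    lineWeight n (fun i j => if (i, j) = p then 1 else 0) =
      ((n - 1).factorial * n.factorial ^ (n - 1)) *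
        ((n - 1).factorial * n.factorial ^ (n - 1)) := by
  obtain ⟨a, b⟩ := p
  have key (a b : Fin n) : ∏ i : Fin n, (n - #{j : Fin n | i = a ∧ j = b}).factorial =
      (n - 1).factorial * n.factorial ^ (n - 1) := by
    rw [← mul_prod_erase univ _ (mem_univ a)]
    congr 1
    · simp [filter_eq']
    · rw [prod_congr rfl (g := fun _ => n.factorial)
        fun i hi => by simp [ne_of_mem_erase hi]]
      simp
  have h (i j : Fin n) : (if (i, j) = (a, b) then (1 : Fin 2) else 0) = 1 ↔ i = a ∧ j = b := by
    simp
  simp only [lineWeight, h]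
  rw [key a b]
  simp only [and_comm (a := _ = a)]
  rw [key b a]

theorem q_one (n : ℕ) (hn : n ≠ 0) : q n 1 = n.factorial ^ n * n.factorial ^ n := by
  have h : q n 1 = ∑ p : Fin n × Fin n,
      lineWeight n (fun i j => if (i, j) = p then 1 else 0) := by
    rw [q_eq_sum_lineWeight]
    symm
    refine sum_bij (fun p _ i j => if (i, j) = p then 1 else 0) ?_ ?_ ?_ fun _ _ => rfl
    · intro p _
      refine mem_filter.2 ⟨mem_univ _, card_eq_one.2 ⟨p, ?_⟩⟩
      ext
      simp
    · intro p _ p' _ h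
      have := congrFun (congrFun h p.1) p.2
      simpa using this
    · intro A hA
      obtain ⟨p, hp⟩ := card_eq_one.1 (mem_filter.1 hA).2
      refine ⟨p, mem_univ p, ?_⟩
      ext i j : 2
      have := congrArg ((i, j) ∈ ·) hp
      simp only [mem_filter, mem_univ, true_and, mem_singleton, eq_iff_iff] at this
      rw [← if_congr this rfl rfl]
      generalize A i j = b
      revert b
      decide
  obtain ⟨m, rfl⟩ := Nat.exists_eq_succ_of_ne_zero hn
  rw [h, sum_congr rfl fun p _ => lineWeight_single _ p]
  simp [Nat.factorial_succ, pow_succ]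
  ring

/-- For `n ≥ 2` and `π ∈ Π_n`, the number of matrices `π' ∈ Π_n` disjoint from `π`
equals `Σ_{k=2}^{n²} (−1)^k q(n,k)`. -/
theorem count_disjoint_pi (n : ℕ) (hn : 2 ≤ n)
    (π : Fin n → Fin n → Fin n × Fin n) (hπ : IsPiMatrix n π) :
    (Nat.card {π' : Fin n → Fin n → Fin n × Fin n //
        IsPiMatrix n π' ∧ DisjointPi n π π'} : ℤ) =
      ∑ k ∈ Finset.Icc 2 (n ^ 2), (-1 : ℤ) ^ k * (q n k : ℤ) := by
  have h : ∑ A : Fin n → Fin n → Fin 2, (-1 : ℤ) ^ eps n A * (lineWeight n A : ℤ) =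
      ∑ k ∈ Icc 0 (n ^ 2), (-1 : ℤ) ^ k * (q n k : ℤ) := by
    rw [← sum_fiberwise_of_maps_to (s := univ) (t := Icc 0 (n ^ 2)) (g := eps n)]
    · refine sum_congr rfl fun k _ => ?_
      rw [q_eq_sum_lineWeight, Nat.cast_sum, mul_sum]
      exact sum_congr rfl fun A hA => by rw [(mem_filter.1 hA).2]
    · intro A _
      rw [mem_Icc, eps]
      exact ⟨Nat.zero_le _, (card_le_univ _).trans (by simp [sq])⟩
  rw [card_disjoint_eq_sum_lineWeight n π hπ, h, ← add_sum_Ioc_eq_sum_Icc (Nat.zero_le _),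
    ← Icc_succ_left_eq_Ioc, ← add_sum_Ioc_eq_sum_Icc (by simp; nlinarith),
    ← Icc_succ_left_eq_Ioc]
  simp [q_zero, q_one n (by omega)]
end

section
/- Let n ≥ 2 be an integer. The number of S-permutation matrices B ∈ Σ_{n²} disjoint from a given A ∈ Σ_{n²} is the same for every choice of A ∈ Σ_{n²}. -/
def IsSPermMatrix (n : ℕ) (A : Fin n × Fin n → Fin n × Fin n → Fin 2) : Prop :=
  (∀ r : Fin n × Fin n, ∃! c : Fin n × Fin n, A r c = 1) ∧
  (∀ c : Fin n × Fin n, ∃! r : Fin n × Fin n, A r c = 1) ∧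
  (∀ i k : Fin n, ∃! p : Fin n × Fin n, A (i, p.1) (k, p.2) = 1)

def DisjointBin (n : ℕ) (A B : Fin n × Fin n → Fin n × Fin n → Fin 2) : Prop :=
  ∀ r c : Fin n × Fin n, ¬(A r c = 1 ∧ B r c = 1)

/-- The position of the unique `1` in block `(i, k)` of an S-permutation matrix is described by
a permutation of each row band and a permutation of each column band. -/
theorem IsSPermMatrix.exists_perms {n : ℕ} {A : Fin n × Fin n → Fin n × Fin n → Fin 2}
    (hA : IsSPermMatrix n A) :
    ∃ ρ σ : Fin n → Equiv.Perm (Fin n),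
      ∀ i j k l, A (i, j) (k, l) = 1 ↔ j = ρ i k ∧ l = σ k i := by
  obtain ⟨hrow, hcol, hblock⟩ := hA
  choose p hp hp_unique using hblock
  beta_reduce at hp hp_unique
  have hρ (i : Fin n) : Function.Injective fun k => (p i k).1 := fun k k' h => by
    have h' := hp i k'
    rw [← show (p i k).1 = (p i k').1 from h] at h'
    exact congrArg Prod.fst ((hrow _).unique (hp i k) h')
  have hσ (k : Fin n) : Function.Injective fun i => (p i k).2 := fun i i' h => by
    have h' := hp i' k
    rw [← show (p i k).2 = (p i' k).2 from h] at h'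
    exact congrArg Prod.fst ((hcol _).unique (hp i k) h')
  refine ⟨fun i => Equiv.ofBijective _ (Finite.injective_iff_bijective.mp (hρ i)),
    fun k => Equiv.ofBijective _ (Finite.injective_iff_bijective.mp (hσ k)), fun i j k l => ?_⟩
  constructor
  · intro h
    exact Prod.ext_iff.mp (hp_unique i k (j, l) h)
  · rintro ⟨rfl, rfl⟩
    exact hp i k

/-- Permuting rows within row bands and columns within column bands preserves S-permutation
matrices. -/
theorem isSPermMatrix_prodShear_iff {n : ℕ} (τ μ : Fin n → Equiv.Perm (Fin n))
    (B : Fin n × Fin n → Fin n × Fin n → Fin 2) :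
    IsSPermMatrix n (fun r c => B (Equiv.prodShear (Equiv.refl _) τ r)
        (Equiv.prodShear (Equiv.refl _) μ c)) ↔ IsSPermMatrix n B := by
  refine and_congr ?_ (and_congr ?_ ?_)
  · exact (Equiv.prodShear (Equiv.refl _) τ).forall_congr fun _ =>
      (Equiv.prodShear (Equiv.refl _) μ).existsUnique_congr fun _ => Iff.rfl
  · exact (Equiv.prodShear (Equiv.refl _) μ).forall_congr fun _ =>
      (Equiv.prodShear (Equiv.refl _) τ).existsUnique_congr fun _ => Iff.rfl
  · exact forall_congr' fun i => forall_congr' fun k =>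
      (Equiv.prodCongr (τ i) (μ k)).existsUnique_congr fun _ => Iff.rfl

/-- Any two S-permutation matrices differ by permutations of rows within row bands and of columns
within column bands. -/
theorem IsSPermMatrix.exists_prodShear {n : ℕ} {A A' : Fin n × Fin n → Fin n × Fin n → Fin 2}
    (hA : IsSPermMatrix n A) (hA' : IsSPermMatrix n A') :
    ∃ τ μ : Fin n → Equiv.Perm (Fin n), ∀ r c,
      A' r c = 1 ↔ A (Equiv.prodShear (Equiv.refl _) τ r)
        (Equiv.prodShear (Equiv.refl _) μ c) = 1 := by
  obtain ⟨ρ, σ, h⟩ := hA.exists_perms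
  obtain ⟨ρ', σ', h'⟩ := hA'.exists_perms
  refine ⟨fun i => (ρ' i).symm.trans (ρ i), fun k => (σ' k).symm.trans (σ k), ?_⟩
  rintro ⟨i, j⟩ ⟨k, l⟩
  simp [h, h', Equiv.symm_apply_eq]

/-- The number of S-permutation matrices disjoint from a given S-permutation matrix `A`
is the same for every choice of `A`. -/
theorem count_disjoint_sperm_independent (n : ℕ) (hn : 2 ≤ n)
    (A A' : Fin n × Fin n → Fin n × Fin n → Fin 2)
    (hA : IsSPermMatrix n A) (hA' : IsSPermMatrix n A') :
    Nat.card {B : Fin n × Fin n → Fin n × Fin n → Fin 2 //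
        IsSPermMatrix n B ∧ DisjointBin n A B} =
    Nat.card {B : Fin n × Fin n → Fin n × Fin n → Fin 2 //
        IsSPermMatrix n B ∧ DisjointBin n A' B} := by
  obtain ⟨τ, μ, h⟩ := hA.exists_prodShear hA'
  let e : Fin n × Fin n ≃ Fin n × Fin n := Equiv.prodShear (Equiv.refl _) τ
  let f : Fin n × Fin n ≃ Fin n × Fin n := Equiv.prodShear (Equiv.refl _) μ
  refine Nat.card_congr (Equiv.subtypeEquiv
    (e.symm.arrowCongr (f.symm.arrowCongr (Equiv.refl _))) fun B => ?_)
  refine and_congr (isSPermMatrix_prodShear_iff τ μ B).symm ?_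
  refine (e.forall_congr fun r => f.forall_congr fun c => ?_).symm
  exact not_congr (and_congr (h r c) Iff.rfl)
end

section
/- The number of unordered pairs {A, B} of distinct disjoint 9×9 S-permutation matrices (case n = 3) is exactly 419250816. -/
section

open Equiv

variable {n : ℕ}

/-- The binary matrix whose one in block `(i, k)` sits in row `σ i k` and column `τ k i` of the
block. -/
def sPermOfPerms (x : (Fin n → Perm (Fin n)) × (Fin n → Perm (Fin n))) :
    Fin n × Fin n → Fin n × Fin n → Fin 2 :=
  fun r c => if x.1 r.1 c.1 = r.2 ∧ x.2 c.1 r.1 = c.2 then 1 else 0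

theorem sPermOfPerms_eq_one_iff (x : (Fin n → Perm (Fin n)) × (Fin n → Perm (Fin n)))
    (i j k l : Fin n) :
    sPermOfPerms x (i, j) (k, l) = 1 ↔ x.1 i k = j ∧ x.2 k i = l := by
  simp [sPermOfPerms]

theorem isSPermMatrix_sPermOfPerms (x : (Fin n → Perm (Fin n)) × (Fin n → Perm (Fin n))) :
    IsSPermMatrix n (sPermOfPerms x) := by
  refine ⟨fun ⟨i, j⟩ => ⟨((x.1 i).symm j, x.2 ((x.1 i).symm j) i), ?_, fun ⟨k, l⟩ h => ?_⟩,
    fun ⟨k, l⟩ => ⟨((x.2 k).symm l, x.1 ((x.2 k).symm l) k), ?_, fun ⟨i, j⟩ h => ?_⟩,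
    fun i k => ⟨(x.1 i k, x.2 k i), ?_, fun ⟨j, l⟩ h => ?_⟩⟩
  any_goals simp [sPermOfPerms_eq_one_iff]
  all_goals
    obtain ⟨rfl, rfl⟩ := (sPermOfPerms_eq_one_iff x _ _ _ _).1 h
    simp

theorem sPermOfPerms_injective :
    Function.Injective (sPermOfPerms (n := n)) := by
  intro x y h
  have key (i k : Fin n) : y.1 i k = x.1 i k ∧ y.2 k i = x.2 k i :=
    (sPermOfPerms_eq_one_iff y _ _ _ _).1
      (h ▸ (sPermOfPerms_eq_one_iff x _ _ _ _).2 ⟨rfl, rfl⟩)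
  ext i k
  · rw [(key i k).1]
  · rw [(key k i).2]

theorem IsSPermMatrix.exists_sPermOfPerms_eq {A : Fin n × Fin n → Fin n × Fin n → Fin 2}
    (hA : IsSPermMatrix n A) : ∃ x, sPermOfPerms x = A := by
  obtain ⟨hrow, hcol, hblock⟩ := hA
  choose p hp hp_unique using hblock
  have hσ (i : Fin n) : Function.Bijective fun k => (p i k).1 := by
    refine Finite.injective_iff_bijective.1 fun k k' h => ?_
    have h' : A (i, (p i k).1) (k', (p i k').2) = 1 := by
      rw [show (p i k).1 = _ from h]
      exact hp i k'
    exact congrArg Prod.fst ((hrow _).unique (hp i k) h')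
  have hτ (k : Fin n) : Function.Bijective fun i => (p i k).2 := by
    refine Finite.injective_iff_bijective.1 fun i i' h => ?_
    have h' : A (i', (p i' k).1) (k, (p i k).2) = 1 := by
      rw [show (p i k).2 = _ from h]
      exact hp i' k
    exact congrArg Prod.fst ((hcol _).unique (hp i k) h')
  refine ⟨(fun i => Equiv.ofBijective _ (hσ i), fun k => Equiv.ofBijective _ (hτ k)), ?_⟩
  have key (a b : Fin 2) (h : a = 1 ↔ b = 1) : a = b := by lia
  ext1 ⟨i, j⟩
  ext1 ⟨k, l⟩
  refine key _ _ ((sPermOfPerms_eq_one_iff _ _ _ _ _).trans ⟨?_, fun h => ?_⟩)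
  · rintro ⟨rfl, rfl⟩
    exact hp i k
  · simp [← hp_unique i k (j, l) h]

/-- S-permutation matrices correspond to pairs of `n`-tuples of permutations. -/
noncomputable def permsEquivSPermMatrix (n : ℕ) :
    (Fin n → Perm (Fin n)) × (Fin n → Perm (Fin n)) ≃
      {A : Fin n × Fin n → Fin n × Fin n → Fin 2 // IsSPermMatrix n A} :=
  Equiv.ofBijective (fun x => ⟨sPermOfPerms x, isSPermMatrix_sPermOfPerms x⟩)
    ⟨fun _ _ h => sPermOfPerms_injective (congrArg Subtype.val h),
      fun A => (A.2.exists_sPermOfPerms_eq).imp fun _ h => Subtype.ext h⟩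

theorem disjointBin_sPermOfPerms_iff (x y : (Fin n → Perm (Fin n)) × (Fin n → Perm (Fin n))) :
    DisjointBin n (sPermOfPerms x) (sPermOfPerms y) ↔
      ∀ i k, ¬((x.1⁻¹ * y.1) i k = k ∧ (x.2⁻¹ * y.2) k i = i) := by
  simp only [DisjointBin, Prod.forall, sPermOfPerms_eq_one_iff, Pi.mul_apply, Pi.inv_apply,
    Perm.mul_apply, Perm.inv_eq_iff_eq]
  constructor
  · exact fun h i k hik => h i _ k _ ⟨⟨rfl, rfl⟩, hik⟩
  · rintro h i _ k _ ⟨⟨rfl, rfl⟩, hik⟩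
    exact h i k hik

/-- The graph on S-permutation matrices joining distinct disjoint matrices. -/
def disjointSPermGraph (n : ℕ) :
    SimpleGraph {A : Fin n × Fin n → Fin n × Fin n → Fin 2 // IsSPermMatrix n A} where
  Adj A B := A ≠ B ∧ DisjointBin n A.1 B.1
  symm := ⟨fun _ _ h => ⟨h.1.symm, fun r c hrc => h.2 r c hrc.symm⟩⟩
  loopless := ⟨fun _ h => h.1 rfl⟩

theorem disjointSPermGraph_adj_iff [NeZero n]
    {x y : (Fin n → Perm (Fin n)) × (Fin n → Perm (Fin n))} :
    (disjointSPermGraph n).Adj (permsEquivSPermMatrix n x) (permsEquivSPermMatrix n y) ↔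
      ∀ i k, ¬((x⁻¹ * y).1 i k = k ∧ (x⁻¹ * y).2 k i = i) := by
  refine Iff.trans ?_ (disjointBin_sPermOfPerms_iff x y)
  refine and_iff_right_of_imp fun h hxy => ?_
  obtain rfl := (permsEquivSPermMatrix n).injective hxy
  exact (disjointBin_sPermOfPerms_iff x x).1 h 0 0 (by simp)

theorem natCard_neighborSet_disjointSPermGraph [NeZero n]
    (A : {A : Fin n × Fin n → Fin n × Fin n → Fin 2 // IsSPermMatrix n A}) :
    Nat.card ((disjointSPermGraph n).neighborSet A) =
      ∑ σ : Fin n → Perm (Fin n), ∏ k,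
        Fintype.card {ρ : Perm (Fin n) // ∀ i, ¬(σ i k = k ∧ ρ i = i)} := by
  obtain ⟨x, rfl⟩ := (permsEquivSPermMatrix n).surjective A
  let e : {y : (Fin n → Perm (Fin n)) × (Fin n → Perm (Fin n)) //
        ∀ i k, ¬(y.1 i k = k ∧ y.2 k i = i)} ≃
      (disjointSPermGraph n).neighborSet (permsEquivSPermMatrix n x) :=
    ((Equiv.mulLeft x).trans (permsEquivSPermMatrix n)).subtypeEquiv fun y => by
      simp [disjointSPermGraph_adj_iff]
  let f : {y : (Fin n → Perm (Fin n)) × (Fin n → Perm (Fin n)) //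
        ∀ i k, ¬(y.1 i k = k ∧ y.2 k i = i)} ≃
      Σ σ : Fin n → Perm (Fin n), ∀ k,
        {ρ : Perm (Fin n) // ∀ i, ¬(σ i k = k ∧ ρ i = i)} :=
    { toFun y := ⟨y.1.1, fun k => ⟨y.1.2 k, fun i => y.2 i k⟩⟩
      invFun y := ⟨(y.1, fun k => (y.2 k).1), fun i k => (y.2 k).2 i⟩
      left_inv _ := rfl
      right_inv _ := rfl }
  rw [← Nat.card_congr (f.symm.trans e), Nat.card_eq_fintype_card, Fintype.card_sigma]
  simp only [Fintype.card_pi]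

theorem sum_prod_card_perm_fin_three :
    ∑ σ : Fin 3 → Perm (Fin 3), ∏ k,
      Fintype.card {ρ : Perm (Fin 3) // ∀ i, ¬(σ i k = k ∧ ρ i = i)} = 17972 := by
  decide +kernel

theorem natCard_sPermMatrix (n : ℕ) :
    Nat.card {A : Fin n × Fin n → Fin n × Fin n → Fin 2 // IsSPermMatrix n A} =
      (n.factorial ^ n) ^ 2 := by
  rw [← Nat.card_congr (permsEquivSPermMatrix n)]
  simp [Fintype.card_perm, sq]

end

/-- The number of unordered pairs of distinct disjoint 9×9 S-permutation matrices
(case `n = 3`) is exactly 419250816. -/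
theorem eta_three :
    Nat.card {s : Sym2 {A : Fin 3 × Fin 3 → Fin 3 × Fin 3 → Fin 2 // IsSPermMatrix 3 A} //
        ∃ A B, s = s(A, B) ∧ A ≠ B ∧ DisjointBin 3 A.1 B.1} = 419250816 := by
  classical
  have hdeg (A) : (disjointSPermGraph 3).degree A = 17972 := by
    rw [← SimpleGraph.card_neighborSet_eq_degree, ← Nat.card_eq_fintype_card,
      natCard_neighborSet_disjointSPermGraph, sum_prod_card_perm_fin_three]
  have hsum := (disjointSPermGraph 3).sum_degrees_eq_twice_card_edges
  have hcard : Nat.card {s : Sym2 {A : Fin 3 × Fin 3 → Fin 3 × Fin 3 → Fin 2 //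
        IsSPermMatrix 3 A} // ∃ A B, s = s(A, B) ∧ A ≠ B ∧ DisjointBin 3 A.1 B.1} =
      (disjointSPermGraph 3).edgeFinset.card := by
    rw [← Nat.card_eq_finsetCard]
    refine Nat.card_congr (Equiv.subtypeEquivRight fun s => ?_)
    rw [SimpleGraph.mem_edgeFinset]
    induction s with | _ A B
    refine ⟨?_, fun h => ⟨A, B, rfl, h⟩⟩
    rintro ⟨A', B', h, hadj⟩
    rw [h]
    exact hadj
  simp only [hdeg, Finset.sum_const, Finset.card_univ, smul_eq_mul, ← Nat.card_eq_fintype_card,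
    natCard_sPermMatrix] at hsum
  norm_num [Nat.factorial] at hsum
  lia
end
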